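/- For every ε ∈ (0,1] there exists N₀ such that for all N ≥ N₀ and every A ⊆ {1,…,N}² with |A| = αN², there exists (m,n) ∈ ℤ² \ {(0,0)} such that |A ∩ (A − (m,n)) ∩ (A − (−n,m))| ≥ (α³ − ε)N², i.e., A contains at least (α³−ε)N² triples of points of the form (a,b), (a+m,b+n), (a−n,b+m) with the same fixed (m,n) ≠ (0,0). -/

import Mathlib

open Finset

namespace PopDiff

set_option linter.unusedSectionVars false

/-- Unnormalised Fourier transform. -/
noncomputable def ft {G : Type} [AddCommGroup G] [Fintype G] (f : G → ℂ) (χ : AddChar G ℂ) : ℂ :=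
  ∑ x, f x * χ x

section Fourier

variable {G : Type} [AddCommGroup G] [Fintype G]

lemma norm_char (χ : AddChar G ℂ) (x : G) : ‖χ x‖ = 1 := by
  simp

lemma ft_inv (f : G → ℂ) (z : G) :
    ∑ χ : AddChar G ℂ, ft f χ * χ (-z) = (Fintype.card G : ℂ) * f z := by
  classical
  have h1 : ∀ χ : AddChar G ℂ, ft f χ * χ (-z) = ∑ x, f x * χ (x - z) := by
    intro χ
    rw [ft, Finset.sum_mul]
    refine Finset.sum_congr rfl fun x _ => ?_
    rw [sub_eq_add_neg, AddChar.map_add_eq_mul]; ring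
  simp_rw [h1]
  rw [Finset.sum_comm]
  simp_rw [← Finset.mul_sum, AddChar.sum_apply_eq_ite, sub_eq_zero]
  simp [mul_comm]

lemma parseval (f : G → ℂ) :
    ∑ χ : AddChar G ℂ, ‖ft f χ‖ ^ 2 = (Fintype.card G : ℝ) * ∑ x, ‖f x‖ ^ 2 := by
  have h : ∑ χ : AddChar G ℂ, ft f χ * (starRingEnd ℂ) (ft f χ)
      = (Fintype.card G : ℂ) * ∑ x, f x * (starRingEnd ℂ) (f x) := by
    have h1 : ∀ χ : AddChar G ℂ, ft f χ * (starRingEnd ℂ) (ft f χ)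
        = ∑ x, (ft f χ * χ (-x)) * (starRingEnd ℂ) (f x) := by
      intro χ
      conv_lhs => rw [ft.eq_1 f χ, map_sum, Finset.mul_sum]
      refine Finset.sum_congr rfl fun x _ => ?_
      rw [map_mul, AddChar.map_neg_eq_conj, ft]; ring
    simp_rw [h1]
    rw [Finset.sum_comm, Finset.mul_sum]
    refine Finset.sum_congr rfl fun x _ => ?_
    rw [← Finset.sum_mul, ft_inv]; ring
  simp_rw [Complex.mul_conj, Complex.normSq_eq_norm_sq] at h
  exact_mod_cast h

lemma parseval_real (f : G → ℝ) :
    ∑ χ : AddChar G ℂ, ‖ft (fun x => (f x : ℂ)) χ‖ ^ 2 = (Fintype.card G : ℝ) * ∑ x, f x ^ 2 := by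
  rw [parseval]; simp

lemma norm_ft_le (f : G → ℂ) (hf : ∀ x, ‖f x‖ ≤ 1) (χ : AddChar G ℂ) :
    ‖ft f χ‖ ≤ Fintype.card G := by
  refine (norm_sum_le _ _).trans ?_
  calc ∑ x, ‖f x * χ x‖ ≤ ∑ _x : G, (1 : ℝ) :=
        Finset.sum_le_sum fun x _ => by rw [norm_mul, norm_char, mul_one]; exact hf x
    _ = _ := by simp

lemma parseval_le (f : G → ℂ) (hf : ∀ x, ‖f x‖ ≤ 1) :
    ∑ χ : AddChar G ℂ, ‖ft f χ‖ ^ 2 ≤ (Fintype.card G : ℝ) ^ 2 := by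
  rw [parseval, sq]
  refine mul_le_mul_of_nonneg_left ?_ (by positivity)
  calc ∑ x, ‖f x‖ ^ 2 ≤ ∑ _x : G, (1 : ℝ) :=
        Finset.sum_le_sum fun x _ => pow_le_one₀ (norm_nonneg _) (hf x)
    _ = _ := by simp

lemma ft_sub (f g : G → ℂ) (χ : AddChar G ℂ) :
    ft (fun x => f x - g x) χ = ft f χ - ft g χ := by
  simp [ft, sub_mul]

lemma ft_mul_char (f : G → ℂ) (η χ : AddChar G ℂ) :
    ft (fun x => f x * η x) χ = ft f (η + χ) := by
  simp only [ft, AddChar.add_apply, mul_assoc]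

/-- Three-fold Cauchy-Schwarz. -/
lemma three_sum {ι : Type*} [Fintype ι] (a b c : ι → ℝ) (_ha : ∀ i, 0 ≤ a i) (hb : ∀ i, 0 ≤ b i)
    (hc : ∀ i, 0 ≤ c i) (τ M : ℝ) (h : ∀ i, a i ≤ τ) (hτ : 0 ≤ τ)
    (hbM : ∑ i, b i ^ 2 ≤ M) (hcM : ∑ i, c i ^ 2 ≤ M) :
    ∑ i, a i * b i * c i ≤ τ * M := by
  calc ∑ i, a i * b i * c i ≤ ∑ i, τ * ((b i ^ 2 + c i ^ 2) / 2) := by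
        refine Finset.sum_le_sum fun i _ => ?_
        rw [mul_assoc]
        refine mul_le_mul (h i) ?_ (mul_nonneg (hb i) (hc i)) hτ
        nlinarith [sq_nonneg (b i - c i)]
    _ = τ * ((∑ i, b i ^ 2 + ∑ i, c i ^ 2) / 2) := by
        rw [← Finset.mul_sum, ← Finset.sum_div, Finset.sum_add_distrib]
    _ ≤ τ * M := by
        refine mul_le_mul_of_nonneg_left ?_ hτ
        linarith

/-- pulled back negated character -/
noncomputable def pb (U : G →+ G) (χ : AddChar G ℂ) : AddChar G ℂ := (-χ).compAddMonoidHom U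

lemma pb_apply (U : G →+ G) (χ : AddChar G ℂ) (x : G) : pb U χ x = χ (-(U x)) := rfl

lemma pb_injective (U : G →+ G) (hU : Function.Surjective U) : Function.Injective (pb U) := by
  intro χ ψ h
  ext x
  obtain ⟨y, hy⟩ := hU (-x)
  have := DFunLike.congr_fun h y
  simpa [pb_apply, hy] using this

lemma bilin_ft (U V : G →+ G) (g0 g1 h : G → ℂ) :
    (Fintype.card G : ℂ) * ∑ x, ∑ y, g0 x * g1 y * h (U x + V y)
      = ∑ χ : AddChar G ℂ, ft h χ * ft g0 (pb U χ) * ft g1 (pb V χ) := by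
  have h1 : ∀ χ : AddChar G ℂ, ft h χ * ft g0 (pb U χ) * ft g1 (pb V χ)
      = ∑ x, ∑ y, g0 x * g1 y * (ft h χ * χ (-(U x + V y))) := by
    intro χ
    rw [mul_assoc, ft.eq_1 g0, ft.eq_1 g1, Finset.sum_mul_sum, Finset.mul_sum]
    refine Finset.sum_congr rfl fun x _ => ?_
    rw [Finset.mul_sum]
    refine Finset.sum_congr rfl fun y _ => ?_
    rw [pb_apply, pb_apply, neg_add, AddChar.map_add_eq_mul]; ring
  simp_rw [h1]
  rw [Finset.mul_sum, Finset.sum_comm]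
  refine Finset.sum_congr rfl fun x _ => ?_
  rw [Finset.mul_sum, Finset.sum_comm]
  refine Finset.sum_congr rfl fun y _ => ?_
  rw [← Finset.mul_sum, ft_inv]; ring

lemma sum_comp_le (σ : AddChar G ℂ → AddChar G ℂ) (hσ : Function.Injective σ)
    (F : AddChar G ℂ → ℝ) (hF : ∀ χ, 0 ≤ F χ) : ∑ χ, F (σ χ) ≤ ∑ χ, F χ := by
  classical
  calc ∑ χ, F (σ χ) = ∑ χ ∈ univ.image σ, F χ := by
        rw [Finset.sum_image (fun _ _ _ _ h => hσ h)]
    _ ≤ _ := Finset.sum_le_sum_of_subset_of_nonneg (Finset.subset_univ _) fun _ _ _ => hF _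

lemma bilin_bound [Nonempty G] (U V : G →+ G) (hU : Function.Surjective U)
    (hV : Function.Surjective V)
    (g0 g1 h : G → ℂ) (h0 : ∀ x, ‖g0 x‖ ≤ 1) (h1 : ∀ x, ‖g1 x‖ ≤ 1) (hh : ∀ x, ‖h x‖ ≤ 1)
    (τ : ℝ) (hτ : 0 ≤ τ)
    (H : (∀ χ, ‖ft g0 χ‖ ≤ τ) ∨ (∀ χ, ‖ft g1 χ‖ ≤ τ) ∨ (∀ χ, ‖ft h χ‖ ≤ τ)) :
    ‖∑ x, ∑ y, g0 x * g1 y * h (U x + V y)‖ ≤ Fintype.card G * τ := by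
  have hn : (0 : ℝ) < Fintype.card G := by exact_mod_cast Fintype.card_pos
  have e := congrArg norm (bilin_ft U V g0 g1 h)
  rw [norm_mul, Complex.norm_natCast] at e
  have p0 : ∑ χ, ‖ft g0 (pb U χ)‖ ^ 2 ≤ (Fintype.card G : ℝ) ^ 2 :=
    (sum_comp_le (pb U) (pb_injective U hU) (fun χ => ‖ft g0 χ‖ ^ 2)
      (fun _ => by positivity)).trans (parseval_le g0 h0)
  have p1 : ∑ χ, ‖ft g1 (pb V χ)‖ ^ 2 ≤ (Fintype.card G : ℝ) ^ 2 :=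
    (sum_comp_le (pb V) (pb_injective V hV) (fun χ => ‖ft g1 χ‖ ^ 2)
      (fun _ => by positivity)).trans (parseval_le g1 h1)
  have p2 := parseval_le h hh
  have key : ∑ χ, ‖ft h χ‖ * ‖ft g0 (pb U χ)‖ * ‖ft g1 (pb V χ)‖
      ≤ τ * (Fintype.card G : ℝ) ^ 2 := by
    rcases H with H | H | H
    · refine le_trans (le_of_eq ?_) (three_sum (fun χ => ‖ft g0 (pb U χ)‖) (fun χ => ‖ft h χ‖)
        (fun χ => ‖ft g1 (pb V χ)‖) (fun _ => norm_nonneg _) (fun _ => norm_nonneg _)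
        (fun _ => norm_nonneg _) τ _ (fun _ => H _) hτ p2 p1)
      exact Finset.sum_congr rfl fun _ _ => by ring
    · refine le_trans (le_of_eq ?_) (three_sum (fun χ => ‖ft g1 (pb V χ)‖) (fun χ => ‖ft h χ‖)
        (fun χ => ‖ft g0 (pb U χ)‖) (fun _ => norm_nonneg _) (fun _ => norm_nonneg _)
        (fun _ => norm_nonneg _) τ _ (fun _ => H _) hτ p2 p0)
      exact Finset.sum_congr rfl fun _ _ => by ring
    · exact three_sum (fun χ => ‖ft h χ‖) (fun χ => ‖ft g0 (pb U χ)‖)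
        (fun χ => ‖ft g1 (pb V χ)‖) (fun _ => norm_nonneg _) (fun _ => norm_nonneg _)
        (fun _ => norm_nonneg _) τ _ (fun _ => H _) hτ p0 p1
  have k2 : ‖∑ χ : AddChar G ℂ, ft h χ * ft g0 (pb U χ) * ft g1 (pb V χ)‖
      ≤ τ * (Fintype.card G : ℝ) ^ 2 := by
    refine (norm_sum_le _ _).trans ?_
    simpa only [norm_mul] using key
  rw [← e] at k2
  have : (Fintype.card G : ℝ) * ‖∑ x, ∑ y, g0 x * g1 y * h (U x + V y)‖
      ≤ Fintype.card G * (Fintype.card G * τ) := by linarith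
  exact le_of_mul_le_mul_left this hn

/-- Probability kernels with nonnegative, summable Fourier transform. -/
structure Ker (β : G → ℝ) (b : AddChar G ℂ → ℝ) (C : ℝ) : Prop where
  nonneg : ∀ d, 0 ≤ β d
  sum_one : ∑ d, β d = 1
  b_nonneg : ∀ χ, 0 ≤ b χ
  b_le : ∀ χ, b χ ≤ 1
  hat : ∀ χ, ft (fun d => (β d : ℂ)) χ = b χ
  sum_le : ∑ χ, b χ ≤ C

lemma Ker.zero_le {β : G → ℝ} {b : AddChar G ℂ → ℝ} {C : ℝ} (h : Ker β b C) :
    Fintype.card G * β 0 ≤ C := by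
  have := ft_inv (fun d => (β d : ℂ)) 0
  simp only [h.hat, neg_zero, AddChar.map_zero_eq_one, mul_one] at this
  have h2 : ∑ χ, b χ = Fintype.card G * β 0 := by exact_mod_cast this
  rw [← h2]; exact h.sum_le

/-- convolution -/
noncomputable def cv (β f : G → ℝ) (x : G) : ℝ := ∑ d, β d * f (x - d)

lemma ft_cv {β : G → ℝ} {b : AddChar G ℂ → ℝ} {C : ℝ} (h : Ker β b C) (f : G → ℝ)
    (χ : AddChar G ℂ) :
    ft (fun x => (cv β f x : ℂ)) χ = b χ * ft (fun x => (f x : ℂ)) χ := by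
  rw [← h.hat, ft.eq_1 (fun d => (β d : ℂ)), Finset.sum_mul, ft]
  simp only [cv, Complex.ofReal_sum, Finset.sum_mul]
  rw [Finset.sum_comm]
  refine Finset.sum_congr rfl fun d _ => ?_
  rw [ft, Finset.mul_sum]
  rw [← Equiv.sum_comp (Equiv.addRight d)]
  refine Finset.sum_congr rfl fun x _ => ?_
  simp [AddChar.map_add_eq_mul]; ring

lemma cv_nonneg {β : G → ℝ} {b : AddChar G ℂ → ℝ} {C : ℝ} (h : Ker β b C) (f : G → ℝ)
    (hf : ∀ x, 0 ≤ f x) (x : G) : 0 ≤ cv β f x :=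
  Finset.sum_nonneg fun d _ => mul_nonneg (h.nonneg d) (hf _)

lemma cv_le {β : G → ℝ} {b : AddChar G ℂ → ℝ} {C : ℝ} (h : Ker β b C) (f : G → ℝ)
    (hf : ∀ x, f x ≤ 1) (x : G) : cv β f x ≤ 1 := by
  rw [← h.sum_one]
  exact Finset.sum_le_sum fun d _ => mul_le_of_le_one_right (h.nonneg d) (hf _)

lemma sum_cv {β : G → ℝ} {b : AddChar G ℂ → ℝ} {C : ℝ} (h : Ker β b C) (f : G → ℝ) :
    ∑ x, cv β f x = ∑ x, f x := by
  simp only [cv]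
  rw [Finset.sum_comm]
  have : ∀ d, ∑ x, β d * f (x - d) = β d * ∑ x, f x := by
    intro d
    rw [← Finset.mul_sum]
    congr 1
    exact Equiv.sum_comp (Equiv.subRight d) f
  simp_rw [this]
  rw [← Finset.sum_mul, h.sum_one, one_mul]

/-- The trilinear form. -/
noncomputable def tri (T : G →+ G) (w f0 f1 f2 : G → ℝ) : ℝ :=
  ∑ d, w d * ∑ x, f0 x * f1 (x + d) * f2 (x + T d)

lemma tri_uniform [Nonempty G] (T : G →+ G) (hT : Function.Surjective T)
    (hU : Function.Surjective (AddMonoidHom.id G - T))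
    {w : G → ℝ} {b : AddChar G ℂ → ℝ} {C : ℝ} (hw : Ker w b C)
    (f0 f1 f2 : G → ℝ) (h0 : ∀ x, |f0 x| ≤ 1) (h1 : ∀ x, |f1 x| ≤ 1) (h2 : ∀ x, |f2 x| ≤ 1)
    (τ : ℝ) (hτ : 0 ≤ τ)
    (H : (∀ χ, ‖ft (fun x => (f0 x : ℂ)) χ‖ ≤ τ) ∨ (∀ χ, ‖ft (fun x => (f1 x : ℂ)) χ‖ ≤ τ) ∨
      (∀ χ, ‖ft (fun x => (f2 x : ℂ)) χ‖ ≤ τ)) :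
    |tri T w f0 f1 f2| ≤ C * τ := by
  have hn : (0 : ℝ) < Fintype.card G := by exact_mod_cast Fintype.card_pos
  have e : (Fintype.card G : ℂ) * (tri T w f0 f1 f2 : ℂ)
      = ∑ η : AddChar G ℂ, (b η : ℂ) * ∑ x, ∑ y, ((f0 x : ℂ) * η x) * ((f1 y : ℂ) * (-η) y)
          * (f2 ((AddMonoidHom.id G - T) x + T y) : ℂ) := by
    have r : ∀ η : AddChar G ℂ,
        ∑ x, ∑ y, ((f0 x : ℂ) * η x) * ((f1 y : ℂ) * (-η) y)
          * (f2 ((AddMonoidHom.id G - T) x + T y) : ℂ)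
        = ∑ d, η (-d) * ∑ x, (f0 x : ℂ) * f1 (x + d) * f2 (x + T d) := by
      intro η
      simp_rw [Finset.mul_sum]
      rw [Finset.sum_comm (s := (univ : Finset G)) (t := (univ : Finset G))
        (f := fun d x => η (-d) * ((f0 x : ℂ) * f1 (x + d) * f2 (x + T d)))]
      refine Finset.sum_congr rfl fun x _ => ?_
      rw [← Equiv.sum_comp (Equiv.addLeft x)]
      refine Finset.sum_congr rfl fun d _ => ?_
      have a1 : (AddMonoidHom.id G - T) x + T (x + d) = x + T d := by
        simp only [AddMonoidHom.sub_apply, AddMonoidHom.id_apply, map_add]; abel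
      simp only [Equiv.coe_addLeft, a1, AddChar.neg_apply]
      have a2 : η (-d) = η x * η (-(x + d)) := by
        rw [← AddChar.map_add_eq_mul]; congr 1; abel
      rw [a2]; ring
    have r2 : ∀ η : AddChar G ℂ,
        (b η : ℂ) * ∑ d, η (-d) * ∑ x, (f0 x : ℂ) * f1 (x + d) * f2 (x + T d)
        = ∑ d, ((b η : ℂ) * η (-d)) * ∑ x, (f0 x : ℂ) * f1 (x + d) * f2 (x + T d) := by
      intro η
      rw [Finset.mul_sum]
      exact Finset.sum_congr rfl fun d _ => by ring
    simp_rw [r, r2]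
    rw [Finset.sum_comm]
    simp only [tri, Complex.ofReal_sum, Complex.ofReal_mul]
    rw [Finset.mul_sum]
    refine Finset.sum_congr rfl fun d _ => ?_
    have i := ft_inv (fun d => (w d : ℂ)) d
    simp only [hw.hat] at i
    rw [← Finset.sum_mul, i]; ring
  have hb : ∀ η : AddChar G ℂ, ‖∑ x, ∑ y, ((f0 x : ℂ) * η x) * ((f1 y : ℂ) * (-η) y)
          * (f2 ((AddMonoidHom.id G - T) x + T y) : ℂ)‖ ≤ Fintype.card G * τ := by
    intro η
    refine bilin_bound (AddMonoidHom.id G - T) T hU hT (fun x => (f0 x : ℂ) * η x)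
      (fun y => (f1 y : ℂ) * (-η) y) (fun z => (f2 z : ℂ)) ?_ ?_ ?_ τ hτ ?_
    · intro x; rw [norm_mul, norm_char, mul_one]; simpa using h0 x
    · intro x; rw [norm_mul, norm_char, mul_one]; simpa using h1 x
    · intro x; simpa using h2 x
    · rcases H with H | H | H
      · left; intro χ; rw [ft_mul_char]; exact H _
      · right; left; intro χ; rw [ft_mul_char]; exact H _
      · right; right; exact H
  have e2 := congrArg norm e
  rw [norm_mul, Complex.norm_natCast, Complex.norm_real, Real.norm_eq_abs] at e2
  have : (Fintype.card G : ℝ) * |tri T w f0 f1 f2| ≤ Fintype.card G * (C * τ) := by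
    rw [e2]
    refine (norm_sum_le _ _).trans ?_
    calc _ ≤ ∑ η : AddChar G ℂ, b η * (Fintype.card G * τ) := by
          refine Finset.sum_le_sum fun η _ => ?_
          rw [norm_mul, Complex.norm_real, Real.norm_of_nonneg (hw.b_nonneg η)]
          exact mul_le_mul_of_nonneg_left (hb η) (hw.b_nonneg η)
      _ = (∑ η, b η) * (Fintype.card G * τ) := by rw [Finset.sum_mul]
      _ ≤ C * (Fintype.card G * τ) :=
          mul_le_mul_of_nonneg_right hw.sum_le (by positivity)
      _ = _ := by ring
  exact le_of_mul_le_mul_left this hn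

end Fourier

section Kernels

variable {G : Type} [AddCommGroup G] [Fintype G]

lemma Ker.mono {β : G → ℝ} {b : AddChar G ℂ → ℝ} {C C' : ℝ} (h : Ker β b C) (hC : C ≤ C') :
    Ker β b C' :=
  ⟨h.nonneg, h.sum_one, h.b_nonneg, h.b_le, h.hat, h.sum_le.trans hC⟩

lemma Ker.one_sub_le {β : G → ℝ} {b : AddChar G ℂ → ℝ} {C : ℝ} (h : Ker β b C)
    (χ : AddChar G ℂ) (δ : ℝ) (hd : ∀ d, β d ≠ 0 → ‖χ d - 1‖ ≤ δ) : 1 - b χ ≤ δ := by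
  have e : ((1 - b χ : ℝ) : ℂ) = ∑ d, (β d : ℂ) * (1 - χ d) := by
    have h1 : ((∑ d, β d : ℝ) : ℂ) = 1 := by rw [h.sum_one]; simp
    simp only [mul_sub, mul_one, Finset.sum_sub_distrib]
    rw [← Complex.ofReal_sum, h1, Complex.ofReal_sub, ← h.hat, ft]; simp
  calc 1 - b χ ≤ |1 - b χ| := le_abs_self _
    _ = ‖((1 - b χ : ℝ) : ℂ)‖ := by rw [Complex.norm_real, Real.norm_eq_abs]
    _ ≤ ∑ d, ‖(β d : ℂ) * (1 - χ d)‖ := by rw [e]; exact norm_sum_le _ _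
    _ ≤ ∑ d, β d * δ := by
        refine Finset.sum_le_sum fun d _ => ?_
        rw [norm_mul, Complex.norm_real, Real.norm_of_nonneg (h.nonneg d)]
        by_cases hz : β d = 0
        · simp [hz]
        · rw [norm_sub_rev]; exact mul_le_mul_of_nonneg_left (hd d hz) (h.nonneg d)
    _ = δ := by rw [← Finset.sum_mul, h.sum_one, one_mul]

lemma exists_ker [Nonempty G] {ι : Type} [Fintype ι] (c : G → ι) :
    ∃ β b, Ker (G := G) β b (Fintype.card ι) ∧
      ∀ d, β d ≠ 0 → ∃ x y, c x = c y ∧ d = x - y := by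
  classical
  have hn : (0 : ℝ) < Fintype.card G := by exact_mod_cast Fintype.card_pos
  have : Nonempty ι := ⟨c (Classical.arbitrary G)⟩
  have hi : (0 : ℝ) < Fintype.card ι := by exact_mod_cast Fintype.card_pos
  obtain ⟨i, hB⟩ := Fintype.exists_le_card_fiber_of_nsmul_le_card (M := ℝ) c
    (b := (Fintype.card G : ℝ) / Fintype.card ι) (by
      rw [nsmul_eq_mul]; exact le_of_eq (by field_simp))
  set B : Finset G := univ.filter (fun x => c x = i) with hBdef
  set k : ℝ := (#B : ℝ) with hk
  have hkpos : 0 < k := lt_of_lt_of_le (by positivity) hB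
  let g : G → ℝ := fun x => if x ∈ B then 1 else 0
  have hg0 : ∀ x, 0 ≤ g x := fun x => by simp only [g]; split_ifs <;> norm_num
  have hgs : ∑ x, g x = k := by simp [g, hk]
  have hgs2 : ∑ x, g x ^ 2 = k := by simp [g, hk]
  have hat : ∀ χ : AddChar G ℂ, ft (fun d => (((∑ x, g x * g (x - d)) / k ^ 2 : ℝ) : ℂ)) χ
      = ((‖ft (fun x => (g x : ℂ)) χ‖ ^ 2 / k ^ 2 : ℝ) : ℂ) := by
    intro χ
    have e1 : ((‖ft (fun x => (g x : ℂ)) χ‖ ^ 2 : ℝ) : ℂ)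
        = ∑ d, ∑ x, (g x : ℂ) * g (x - d) * χ d := by
      rw [← Complex.normSq_eq_norm_sq, ← Complex.mul_conj, ft, map_sum, Finset.sum_mul_sum,
        Finset.sum_comm (f := fun d x => (g x : ℂ) * g (x - d) * χ d)]
      refine Finset.sum_congr rfl fun x _ => ?_
      rw [← Equiv.sum_comp (Equiv.subLeft x)]
      refine Finset.sum_congr rfl fun d _ => ?_
      simp only [Equiv.subLeft_apply, map_mul, Complex.conj_ofReal, ← AddChar.map_neg_eq_conj]
      have : χ d = χ x * χ (-(x - d)) := by
        rw [← AddChar.map_add_eq_mul]; congr 1; abel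
      rw [this]; ring
    rw [Complex.ofReal_div, e1, ft, Finset.sum_div]
    refine Finset.sum_congr rfl fun d _ => ?_
    rw [← Finset.sum_mul]
    push_cast
    ring
  refine ⟨fun d => (∑ x, g x * g (x - d)) / k ^ 2,
    fun χ => ‖ft (fun x => (g x : ℂ)) χ‖ ^ 2 / k ^ 2, ⟨?_, ?_, ?_, ?_, hat, ?_⟩, ?_⟩
  · intro d
    exact div_nonneg (Finset.sum_nonneg fun x _ => mul_nonneg (hg0 _) (hg0 _)) (by positivity)
  · rw [← Finset.sum_div, Finset.sum_comm]
    have : ∀ x, ∑ d, g x * g (x - d) = g x * k := by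
      intro x
      rw [← Finset.mul_sum, ← hgs]
      congr 1
      exact Equiv.sum_comp (Equiv.subLeft x) g
    simp_rw [this]
    rw [← Finset.sum_mul, hgs]
    field_simp
  · intro χ; positivity
  · intro χ
    rw [div_le_one (by positivity)]
    refine pow_le_pow_left₀ (norm_nonneg _) ?_ 2
    refine (norm_sum_le _ _).trans ?_
    rw [← hgs]
    refine Finset.sum_le_sum fun x _ => ?_
    rw [norm_mul, norm_char, mul_one, Complex.norm_real, Real.norm_of_nonneg (hg0 x)]
  · rw [← Finset.sum_div, parseval_real, hgs2]
    rw [div_le_iff₀ (by positivity)]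
    have := (div_le_iff₀ hi).1 hB
    nlinarith
  · intro d hd
    have : ∑ x, g x * g (x - d) ≠ 0 := fun h => hd (by simp [h])
    obtain ⟨x, _, hx⟩ := Finset.exists_ne_zero_of_sum_ne_zero this
    have hx1 : x ∈ B := by
      by_contra hc; exact hx (by simp [g, hc])
    have hx2 : x - d ∈ B := by
      by_contra hc; exact hx (by simp [g, hc])
    simp only [hBdef, Finset.mem_filter, Finset.mem_univ, true_and] at hx1 hx2
    exact ⟨x, x - d, by rw [hx1, hx2], by abel⟩

lemma exists_col (δ : ℝ) (hδ : 0 < δ) : ∃ (t : Finset ℂ) (col : ℂ → t),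
    ∀ z w : ℂ, ‖z‖ = 1 → ‖w‖ = 1 → col z = col w → ‖z - w‖ ≤ δ := by
  classical
  have hc : TotallyBounded (Metric.sphere (0 : ℂ) 1) := (isCompact_sphere 0 1).totallyBounded
  obtain ⟨t, ht, hcov⟩ := Metric.totallyBounded_iff.1 hc (δ / 2) (by positivity)
  have hex : ∀ z : ℂ, ‖z‖ = 1 → ∃ y ∈ ht.toFinset, dist z y < δ / 2 := by
    intro z hz
    have := hcov (show z ∈ Metric.sphere (0 : ℂ) 1 by simpa using hz)
    simp only [Set.mem_iUnion, Metric.mem_ball] at this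
    obtain ⟨y, hy, hd⟩ := this
    exact ⟨y, by simpa using hy, hd⟩
  obtain ⟨y0, hy0, _⟩ := hex 1 (by simp)
  refine ⟨ht.toFinset, fun z => if hz : ‖z‖ = 1 then
    ⟨(hex z hz).choose, (hex z hz).choose_spec.1⟩ else ⟨y0, hy0⟩, ?_⟩
  intro z w hz hw h
  simp only [hz, hw, dite_true, Subtype.mk.injEq] at h
  have h1 := (hex z hz).choose_spec.2
  have h2 := (hex w hw).choose_spec.2
  rw [← h] at h2
  rw [← dist_eq_norm]
  have := dist_triangle_right z w (hex z hz).choose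
  linarith

end Kernels

lemma exists_ker_bohr (m p : ℕ) (δ : ℝ) (hδ : 0 < δ) : ∃ C : ℝ, 0 < C ∧
    ∀ (G : Type) [AddCommGroup G] [Fintype G] (c : G → Fin m) (S : Finset (AddChar G ℂ)),
      #S ≤ p → ∃ w b, Ker (G := G) w b C ∧
        ∀ d, w d ≠ 0 → (∃ x y, c x = c y ∧ d = x - y) ∧ ∀ χ ∈ S, ‖χ d - 1‖ ≤ δ := by
  classical
  obtain ⟨t, col, hcol⟩ := exists_col δ hδ
  refine ⟨m * (#t + 1 : ℝ) ^ p + 1, by positivity, ?_⟩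
  intro G _ _ c S hS
  obtain ⟨w, b, hk, hs⟩ := exists_ker (G := G) (ι := Fin m × (S → t))
    (fun x => (c x, fun χ => col (χ.1 x)))
  refine ⟨w, b, hk.mono ?_, ?_⟩
  · simp only [Fintype.card_prod, Fintype.card_fin, Fintype.card_fun, Fintype.card_coe]
    push_cast
    have h1 : (#t : ℝ) ^ #S ≤ (#t + 1 : ℝ) ^ p :=
      (pow_le_pow_left₀ (by positivity) (by linarith) _).trans
        (pow_le_pow_right₀ (by linarith [(Nat.cast_nonneg #t : (0 : ℝ) ≤ #t)]) hS)
    have := mul_le_mul_of_nonneg_left h1 (Nat.cast_nonneg m : (0 : ℝ) ≤ m)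
    linarith
  · intro d hd
    obtain ⟨x, y, hxy, rfl⟩ := hs d hd
    rw [Prod.mk.injEq] at hxy
    refine ⟨⟨x, y, hxy.1, rfl⟩, ?_⟩
    intro χ hχ
    have h1 : col (χ x) = col (χ y) := congrFun hxy.2 ⟨χ, hχ⟩
    have h2 := hcol _ _ (norm_char χ x) (norm_char χ y) h1
    have h3 : χ x - χ y = (χ (x - y) - 1) * χ y := by
      rw [sub_mul, ← AddChar.map_add_eq_mul]; simp
    rwa [h3, norm_mul, norm_char, mul_one] at h2

section Compare

variable {G : Type} [AddCommGroup G] [Fintype G]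

lemma trid_l1 (f0 f1 f2 : G → ℝ) (d e : G) (h0 : ∀ x, |f0 x| ≤ 1) (h1 : ∀ x, |f1 x| ≤ 1)
    (h2 : ∀ x, |f2 x| ≤ 1) (K : ℝ)
    (H : ∑ x, |f0 x| ≤ K ∨ ∑ x, |f1 x| ≤ K ∨ ∑ x, |f2 x| ≤ K) :
    |∑ x, f0 x * f1 (x + d) * f2 (x + e)| ≤ K := by
  refine (Finset.abs_sum_le_sum_abs _ _).trans ?_
  simp only [abs_mul]
  have m1 : ∀ a b c : ℝ, 0 ≤ a → 0 ≤ b → 0 ≤ c → b ≤ 1 → c ≤ 1 → a * b * c ≤ a := by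
    intro a b c ha hb hc hb1 hc1
    calc a * b * c ≤ a * 1 * 1 := by gcongr
      _ = a := by ring
  rcases H with H | H | H
  · refine le_trans (Finset.sum_le_sum fun x _ => ?_) H
    exact m1 _ _ _ (abs_nonneg _) (abs_nonneg _) (abs_nonneg _) (h1 _) (h2 _)
  · rw [← Equiv.sum_comp (Equiv.addRight d)] at H
    refine le_trans (Finset.sum_le_sum fun x _ => ?_) H
    rw [mul_comm |f0 x|]
    exact m1 _ _ _ (abs_nonneg _) (abs_nonneg _) (abs_nonneg _) (h0 _) (h2 _)
  · rw [← Equiv.sum_comp (Equiv.addRight e)] at H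
    refine le_trans (Finset.sum_le_sum fun x _ => ?_) H
    rw [mul_comm _ |f2 (x + e)|, ← mul_assoc]
    exact m1 _ _ _ (abs_nonneg _) (abs_nonneg _) (abs_nonneg _) (h0 _) (h1 _)

lemma tri_l1 (T : G →+ G) {w : G → ℝ} {b : AddChar G ℂ → ℝ} {C : ℝ} (hw : Ker w b C)
    (f0 f1 f2 : G → ℝ) (h0 : ∀ x, |f0 x| ≤ 1) (h1 : ∀ x, |f1 x| ≤ 1)
    (h2 : ∀ x, |f2 x| ≤ 1) (K : ℝ)
    (H : ∑ x, |f0 x| ≤ K ∨ ∑ x, |f1 x| ≤ K ∨ ∑ x, |f2 x| ≤ K) :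
    |tri T w f0 f1 f2| ≤ K := by
  refine (Finset.abs_sum_le_sum_abs _ _).trans ?_
  calc _ ≤ ∑ d, w d * K := by
        refine Finset.sum_le_sum fun d _ => ?_
        rw [abs_mul, abs_of_nonneg (hw.nonneg d)]
        exact mul_le_mul_of_nonneg_left (trid_l1 f0 f1 f2 d (T d) h0 h1 h2 K H) (hw.nonneg d)
    _ = K := by rw [← Finset.sum_mul, hw.sum_one, one_mul]

lemma tri_telescope (T : G →+ G) (w f g : G → ℝ) :
    tri T w f f f = tri T w g g g + tri T w (fun x => f x - g x) f f
      + tri T w g (fun x => f x - g x) f + tri T w g g (fun x => f x - g x) := by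
  simp only [tri, ← Finset.sum_add_distrib, ← mul_add]
  refine Finset.sum_congr rfl fun d _ => ?_
  congr 1
  exact Finset.sum_congr rfl fun x _ => by ring

lemma abs_le_one_of {a : ℝ} (h : 0 ≤ a) (h' : a ≤ 1) : |a| ≤ 1 := by
  rw [abs_of_nonneg h]; exact h'

lemma abs_sub_le_one_of {a c : ℝ} (h : 0 ≤ a) (h' : a ≤ 1) (k : 0 ≤ c) (k' : c ≤ 1) :
    |a - c| ≤ 1 := by
  rw [abs_le]; constructor <;> linarith

lemma cmp_uniform [Nonempty G] (T : G →+ G) (hT : Function.Surjective T)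
    (hU : Function.Surjective (AddMonoidHom.id G - T))
    {w : G → ℝ} {b : AddChar G ℂ → ℝ} {C : ℝ} (hw : Ker w b C)
    (f g : G → ℝ) (f0 : ∀ x, 0 ≤ f x) (f1 : ∀ x, f x ≤ 1) (g0 : ∀ x, 0 ≤ g x) (g1 : ∀ x, g x ≤ 1)
    (τ : ℝ) (hτ : 0 ≤ τ) (H : ∀ χ, ‖ft (fun x => ((f x - g x : ℝ) : ℂ)) χ‖ ≤ τ) :
    tri T w g g g - 3 * (C * τ) ≤ tri T w f f f := by
  have hf := fun x => abs_le_one_of (f0 x) (f1 x)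
  have hg := fun x => abs_le_one_of (g0 x) (g1 x)
  have hh := fun x => abs_sub_le_one_of (f0 x) (f1 x) (g0 x) (g1 x)
  have a := tri_uniform T hT hU hw (fun x => f x - g x) f f hh hf hf τ hτ (Or.inl H)
  have b := tri_uniform T hT hU hw g (fun x => f x - g x) f hg hh hf τ hτ (Or.inr (Or.inl H))
  have c := tri_uniform T hT hU hw g g (fun x => f x - g x) hg hg hh τ hτ (Or.inr (Or.inr H))
  rw [tri_telescope T w f g]
  linarith [(abs_le.1 a).1, (abs_le.1 b).1, (abs_le.1 c).1]

lemma cmp_l1 (T : G →+ G)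
    {w : G → ℝ} {b : AddChar G ℂ → ℝ} {C : ℝ} (hw : Ker w b C)
    (f g : G → ℝ) (f0 : ∀ x, 0 ≤ f x) (f1 : ∀ x, f x ≤ 1) (g0 : ∀ x, 0 ≤ g x) (g1 : ∀ x, g x ≤ 1)
    (K : ℝ) (H : ∑ x, |f x - g x| ≤ K) :
    tri T w g g g - 3 * K ≤ tri T w f f f := by
  have hf := fun x => abs_le_one_of (f0 x) (f1 x)
  have hg := fun x => abs_le_one_of (g0 x) (g1 x)
  have hh := fun x => abs_sub_le_one_of (f0 x) (f1 x) (g0 x) (g1 x)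
  have a := tri_l1 T hw (fun x => f x - g x) f f hh hf hf K (Or.inl H)
  have b := tri_l1 T hw g (fun x => f x - g x) f hg hh hf K (Or.inr (Or.inl H))
  have c := tri_l1 T hw g g (fun x => f x - g x) hg hg hh K (Or.inr (Or.inr H))
  rw [tri_telescope T w f g]
  linarith [(abs_le.1 a).1, (abs_le.1 b).1, (abs_le.1 c).1]

lemma cmp_shift (T : G →+ G)
    {w : G → ℝ} {b : AddChar G ℂ → ℝ} {C : ℝ} (hw : Ker w b C)
    (g : G → ℝ) (g0 : ∀ x, 0 ≤ g x) (g1 : ∀ x, g x ≤ 1)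
    (K : ℝ) (H : ∀ d, w d ≠ 0 → ∑ x, |g (x + d) - g x| ≤ K ∧ ∑ x, |g (x + T d) - g x| ≤ K) :
    ∑ x, g x ^ 3 - 2 * K ≤ tri T w g g g := by
  have e : ∑ x, g x ^ 3 - 2 * K = ∑ d, w d * (∑ x, g x ^ 3 - 2 * K) := by
    rw [← Finset.sum_mul, hw.sum_one, one_mul]
  rw [e]
  refine Finset.sum_le_sum fun d _ => ?_
  by_cases hd : w d = 0
  · simp [hd]
  refine mul_le_mul_of_nonneg_left ?_ (hw.nonneg d)
  obtain ⟨h1, h2⟩ := H d hd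
  have : ∑ x, (g x ^ 3 - |g (x + d) - g x| - |g (x + T d) - g x|)
      ≤ ∑ x, g x * g (x + d) * g (x + T d) := by
    refine Finset.sum_le_sum fun x _ => ?_
    have i1 : g x * g (x + d) * g (x + T d) = g x ^ 3 + (g x * g (x + T d)) * (g (x + d) - g x)
        + (g x * g x) * (g (x + T d) - g x) := by ring
    have k : ∀ a c u : ℝ, 0 ≤ a → a ≤ 1 → 0 ≤ c → c ≤ 1 → -|u| ≤ a * c * u := by
      intro a c u ha ha1 hc hc1
      have p : a * c ≤ 1 := mul_le_one₀ ha1 hc hc1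
      have p0 : 0 ≤ a * c := mul_nonneg ha hc
      have := neg_abs_le u
      have q := abs_nonneg u
      nlinarith
    have k1 := k (g x) (g (x + T d)) (g (x + d) - g x) (g0 _) (g1 _) (g0 _) (g1 _)
    have k2 := k (g x) (g x) (g (x + T d) - g x) (g0 _) (g1 _) (g0 _) (g1 _)
    rw [i1]; linarith
  rw [Finset.sum_sub_distrib, Finset.sum_sub_distrib] at this
  linarith

lemma abs_sum_of_sq (h : G → ℝ) (κ : ℝ) (hκ : 0 ≤ κ)
    (H : ∑ x, h x ^ 2 ≤ κ ^ 2 * Fintype.card G) : ∑ x, |h x| ≤ κ * Fintype.card G := by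
  have h1 := sq_sum_le_card_mul_sum_sq (s := (univ : Finset G)) (f := fun x => |h x|)
  simp only [sq_abs, Finset.card_univ] at h1
  refine abs_le_of_sq_le_sq' ?_ (by positivity) |>.2
  have hn : (0 : ℝ) ≤ Fintype.card G := by positivity
  nlinarith

lemma shift_small {β : G → ℝ} {b : AddChar G ℂ → ℝ} {C : ℝ} [Nonempty G] (hβ : Ker β b C)
    (f : G → ℝ) (f0 : ∀ x, 0 ≤ f x) (f1 : ∀ x, f x ≤ 1) (τ : ℝ) (hτ : 0 ≤ τ) (d : G)
    (hd : ∀ χ, b χ * ‖χ d - 1‖ ≤ 2 * τ) :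
    ∑ x, |cv β f (x + d) - cv β f x| ≤ 2 * τ * Fintype.card G := by
  have hn : (0 : ℝ) < Fintype.card G := by exact_mod_cast Fintype.card_pos
  refine abs_sum_of_sq (fun x => cv β f (x + d) - cv β f x) (2 * τ) (by positivity) ?_
  have p := parseval_real (fun x => cv β f (x + d) - cv β f x)
  have e : ∀ χ : AddChar G ℂ, ft (fun x => ((cv β f (x + d) - cv β f x : ℝ) : ℂ)) χ
      = (χ (-d) - 1) * (b χ * ft (fun x => (f x : ℂ)) χ) := by
    intro χ
    have s : ft (fun x => (cv β f (x + d) : ℂ)) χ = χ (-d) * ft (fun x => (cv β f x : ℂ)) χ := by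
      rw [ft, ft, Finset.mul_sum, ← Equiv.sum_comp (Equiv.addRight d)
        (fun x => χ (-d) * ((cv β f x : ℂ) * χ x))]
      refine Finset.sum_congr rfl fun x _ => ?_
      have : χ x = χ (-d) * χ (x + d) := by
        rw [← AddChar.map_add_eq_mul]; congr 1; abel
      simp only [Equiv.coe_addRight]
      rw [this]; ring
    simp only [Complex.ofReal_sub]
    rw [ft_sub, s, ft_cv hβ]; ring
  have q : ∑ χ, ‖ft (fun x => ((cv β f (x + d) - cv β f x : ℝ) : ℂ)) χ‖ ^ 2
      ≤ (2 * τ) ^ 2 * (Fintype.card G : ℝ) ^ 2 := by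
    calc _ ≤ ∑ χ, (2 * τ) ^ 2 * ‖ft (fun x => (f x : ℂ)) χ‖ ^ 2 := by
          refine Finset.sum_le_sum fun χ _ => ?_
          have n1 : ‖χ (-d) - 1‖ = ‖χ d - 1‖ := by
            have : χ d - 1 = (1 - χ (-d)) * χ d := by
              rw [sub_mul, ← AddChar.map_add_eq_mul]; simp
            rw [this, norm_mul, norm_char, mul_one, norm_sub_rev]
          rw [e, norm_mul, norm_mul, n1, Complex.norm_real, Real.norm_of_nonneg (hβ.b_nonneg χ),
            ← mul_assoc, mul_comm ‖χ d - 1‖, mul_pow]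
          refine mul_le_mul_of_nonneg_right ?_ (by positivity)
          exact pow_le_pow_left₀ (mul_nonneg (hβ.b_nonneg χ) (norm_nonneg _)) (hd χ) 2
      _ ≤ _ := by
          rw [← Finset.mul_sum]
          refine mul_le_mul_of_nonneg_left (parseval_le _ ?_) (by positivity)
          intro x
          rw [Complex.norm_real]; exact abs_le_one_of (f0 x) (f1 x)
  rw [p] at q
  have : (Fintype.card G : ℝ) * ∑ x, (cv β f (x + d) - cv β f x) ^ 2
      ≤ Fintype.card G * ((2 * τ) ^ 2 * Fintype.card G) := by linarith
  exact le_of_mul_le_mul_left this hn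

lemma energy_diff {β β' : G → ℝ} {b b' : AddChar G ℂ → ℝ} {C C' : ℝ} [Nonempty G]
    (hβ : Ker β b C) (hβ' : Ker β' b' C')
    (f : G → ℝ) (f0 : ∀ x, 0 ≤ f x) (f1 : ∀ x, f x ≤ 1) (τ : ℝ) (hτ : 0 ≤ τ)
    (hb : ∀ χ, b χ * (1 - b' χ) ≤ τ) :
    ∑ x, (cv β' f x - cv β f x) ^ 2
      ≤ ∑ x, cv β' f x ^ 2 - ∑ x, cv β f x ^ 2 + 2 * τ * Fintype.card G := by
  have hn : (0 : ℝ) < Fintype.card G := by exact_mod_cast Fintype.card_pos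
  set F : AddChar G ℂ → ℝ := fun χ => ‖ft (fun x => (f x : ℂ)) χ‖ ^ 2 with hF
  have p0 : ∑ χ, (b' χ - b χ) ^ 2 * F χ = Fintype.card G * ∑ x, (cv β' f x - cv β f x) ^ 2 := by
    rw [← parseval_real]
    refine Finset.sum_congr rfl fun χ _ => ?_
    simp only [Complex.ofReal_sub]
    rw [ft_sub, ft_cv hβ, ft_cv hβ', ← sub_mul, norm_mul, mul_pow, ← Complex.ofReal_sub,
      Complex.norm_real, Real.norm_eq_abs, sq_abs]
  have pk : ∀ {γ : G → ℝ} {a : AddChar G ℂ → ℝ} {D : ℝ}, Ker γ a D →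
      ∑ χ, (a χ) ^ 2 * F χ = Fintype.card G * ∑ x, cv γ f x ^ 2 := by
    intro γ a D h
    rw [← parseval_real]
    refine Finset.sum_congr rfl fun χ _ => ?_
    rw [ft_cv h, norm_mul, mul_pow, Complex.norm_real, Real.norm_eq_abs, sq_abs]
  have pf : ∑ χ, F χ ≤ (Fintype.card G : ℝ) ^ 2 := by
    refine parseval_le _ fun x => ?_
    rw [Complex.norm_real]; exact abs_le_one_of (f0 x) (f1 x)
  have key : ∑ χ, (b' χ - b χ) ^ 2 * F χ
      ≤ ∑ χ, (b' χ ^ 2 * F χ - b χ ^ 2 * F χ + 2 * τ * F χ) := by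
    refine Finset.sum_le_sum fun χ _ => ?_
    have hF0 : 0 ≤ F χ := by positivity
    have : (b' χ - b χ) ^ 2 ≤ b' χ ^ 2 - b χ ^ 2 + 2 * τ := by
      nlinarith [hb χ, hβ.b_nonneg χ, hβ.b_le χ]
    nlinarith
  rw [Finset.sum_add_distrib, Finset.sum_sub_distrib, pk hβ, pk hβ', p0, ← Finset.mul_sum] at key
  have : (Fintype.card G : ℝ) * ∑ x, (cv β' f x - cv β f x) ^ 2 ≤ Fintype.card G *
      (∑ x, cv β' f x ^ 2 - ∑ x, cv β f x ^ 2 + 2 * τ * Fintype.card G) := by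
    nlinarith
  exact le_of_mul_le_mul_left this hn

lemma card_large {ι : Type*} [Fintype ι] (F : ι → ℝ) (hF : ∀ i, 0 ≤ F i) (M τ : ℝ) (hτ : 0 < τ)
    (h : ∑ i, F i ≤ M) : #(univ.filter fun i => τ ≤ F i) ≤ ⌊M / τ⌋₊ := by
  refine Nat.le_floor ?_
  rw [le_div_iff₀ hτ]
  refine le_trans ?_ h
  calc (#(univ.filter fun i => τ ≤ F i) : ℝ) * τ = ∑ i ∈ univ.filter fun i => τ ≤ F i, τ := by simp
    _ ≤ ∑ i ∈ univ.filter fun i => τ ≤ F i, F i :=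
        Finset.sum_le_sum fun i hi => (Finset.mem_filter.1 hi).2
    _ ≤ _ := Finset.sum_le_sum_of_subset_of_nonneg (Finset.subset_univ _) fun i _ _ => hF i

lemma cube_mean [Nonempty G] (g : G → ℝ) (g0 : ∀ x, 0 ≤ g x) :
    ((∑ x, g x) / Fintype.card G) ^ 3 * Fintype.card G ≤ ∑ x, g x ^ 3 := by
  have hn : (0 : ℝ) < Fintype.card G := by exact_mod_cast Fintype.card_pos
  have h := pow_sum_div_card_le_sum_pow (s := (univ : Finset G)) (f := g) (n := 2)
    (fun x _ => g0 x)
  simp only [Finset.card_univ] at h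
  refine le_trans (le_of_eq ?_) h
  field_simp

end Compare

lemma main_iter (κ : ℝ) (hκ : 0 < κ) (hκ1 : κ ≤ 1) (m : ℕ) : ∀ (j : ℕ) (C : ℝ), ∃ C' : ℝ,
    ∀ (G : Type) [AddCommGroup G] [Fintype G] (T : G →+ G) (_ : Function.Surjective T)
      (_ : Function.Surjective (AddMonoidHom.id G - T)) (c : G → Fin m) (f : G → ℝ)
      (_ : ∀ x, 0 ≤ f x) (_ : ∀ x, f x ≤ 1) (β : G → ℝ) (b : AddChar G ℂ → ℝ) (_ : Ker β b C),
      (Fintype.card G : ℝ) < ∑ x, cv β f x ^ 2 + j * (κ ^ 2 / 2) * Fintype.card G →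
      ∃ w bw, Ker (G := G) w bw C' ∧ (∀ d, w d ≠ 0 → ∃ x y, c x = c y ∧ d = x - y) ∧
        (((∑ x, f x) / Fintype.card G) ^ 3 - 7 * κ) * Fintype.card G ≤ tri T w f f f := by
  classical
  intro j
  induction j with
  | zero =>
    intro C
    refine ⟨0, ?_⟩
    intro G _ _ T _ _ c f f0 f1 β b hβ h
    exfalso
    have : ∑ x, cv β f x ^ 2 ≤ ∑ _x : G, (1 : ℝ) :=
      Finset.sum_le_sum fun x _ => pow_le_one₀ (cv_nonneg hβ f f0 x) (cv_le hβ f f1 x)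
    simp only [Finset.sum_const, Finset.card_univ, nsmul_eq_mul, mul_one] at this
    simp only [Nat.cast_zero, zero_mul, add_zero] at h
    linarith
  | succ j ih =>
    intro C
    set τ : ℝ := κ ^ 2 / 4 with hτdef
    have hτ : 0 < τ := by positivity
    obtain ⟨Cw, hCw, Hw⟩ := exists_ker_bohr m (⌊C / τ⌋₊ + ⌊C / τ⌋₊) τ hτ
    set σ : ℝ := κ / Cw with hσdef
    have hσ : 0 < σ := by positivity
    obtain ⟨Cb, hCb, Hb⟩ := exists_ker_bohr m (⌊C / τ⌋₊ + ⌊1 / σ ^ 2⌋₊) (min τ σ) (by positivity)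
    obtain ⟨C', HC'⟩ := ih Cb
    refine ⟨max Cw C', ?_⟩
    intro G _ _ T hT hU c f f0 f1 β b hβ hE
    have hn : (0 : ℝ) < Fintype.card G := by exact_mod_cast Fintype.card_pos
    have hnf : ∀ x, ‖(f x : ℂ)‖ ≤ 1 := fun x => by
      rw [Complex.norm_real]; exact abs_le_one_of (f0 x) (f1 x)
    set S : Finset (AddChar G ℂ) := univ.filter fun χ => τ ≤ b χ with hS
    have cS : #S ≤ ⌊C / τ⌋₊ := card_large b hβ.b_nonneg C τ hτ hβ.sum_le
    set S2 : Finset (AddChar G ℂ) :=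
      univ.filter fun χ => σ ^ 2 ≤ ‖ft (fun x => (f x : ℂ)) χ‖ ^ 2 / (Fintype.card G : ℝ) ^ 2
      with hS2
    have cS2 : #S2 ≤ ⌊1 / σ ^ 2⌋₊ := by
      refine card_large _ (fun _ => by positivity) 1 _ (by positivity) ?_
      rw [← Finset.sum_div, div_le_one (by positivity)]
      exact parseval_le _ hnf
    obtain ⟨w, bw, hw, hws⟩ := Hw G c (S ∪ S.image fun χ => χ.compAddMonoidHom T)
      ((Finset.card_union_le _ _).trans (add_le_add cS (Finset.card_image_le.trans cS)))
    obtain ⟨β', b', hβ', hbs⟩ := Hb G c (S ∪ S2)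
      ((Finset.card_union_le _ _).trans (add_le_add cS cS2))
    have hb1 : ∀ χ, b χ * (1 - b' χ) ≤ τ := by
      intro χ
      have p0 := hβ.b_nonneg χ
      have p1 := hβ.b_le χ
      have q0 := hβ'.b_nonneg χ
      have q1 := hβ'.b_le χ
      by_cases h : τ ≤ b χ
      · have hχ : χ ∈ S := by simp [hS, h]
        have := hβ'.one_sub_le χ (min τ σ)
          fun d hd => (hbs d hd).2 χ (Finset.mem_union_left _ hχ)
        have := this.trans (min_le_left _ _)
        nlinarith
      · push Not at h
        nlinarith
    by_cases hinc : ∑ x, cv β f x ^ 2 + κ ^ 2 / 2 * Fintype.card G < ∑ x, cv β' f x ^ 2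
    · obtain ⟨w2, bw2, h1, h2, h3⟩ := HC' G T hT hU c f f0 f1 β' b' hβ' (by
        push_cast at hE
        linarith)
      exact ⟨w2, bw2, h1.mono (le_max_right _ _), h2, h3⟩
    · push Not at hinc
      refine ⟨w, bw, hw.mono (le_max_left _ _), fun d hd => (hws d hd).1, ?_⟩
      have g0 := cv_nonneg hβ f f0
      have g1 := cv_le hβ f f1
      have g0' := cv_nonneg hβ' f f0
      have g1' := cv_le hβ' f f1
      have e1 : tri T w (cv β' f) (cv β' f) (cv β' f) - 3 * (Cw * (σ * Fintype.card G))
          ≤ tri T w f f f := by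
        refine cmp_uniform T hT hU hw f (cv β' f) f0 f1 g0' g1' _ (by positivity) ?_
        intro χ
        simp only [Complex.ofReal_sub]
        rw [ft_sub, ft_cv hβ', ← one_sub_mul, norm_mul]
        have q0 := hβ'.b_nonneg χ
        have q1 := hβ'.b_le χ
        have r : ‖(1 : ℂ) - b' χ‖ = 1 - b' χ := by
          rw [← Complex.ofReal_one, ← Complex.ofReal_sub, Complex.norm_real,
            Real.norm_of_nonneg (by linarith)]
        rw [r]
        have u := norm_ft_le _ hnf χ
        have u0 := norm_nonneg (ft (fun x => (f x : ℂ)) χ)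
        by_cases h : χ ∈ S2
        · have := hβ'.one_sub_le χ (min τ σ)
            fun d hd => (hbs d hd).2 χ (Finset.mem_union_right _ h)
          exact mul_le_mul (this.trans (min_le_right _ _)) u u0 hσ.le
        · have h' : ‖ft (fun x => (f x : ℂ)) χ‖ ^ 2 / (Fintype.card G : ℝ) ^ 2 < σ ^ 2 := by
            simpa [hS2] using h
          rw [div_lt_iff₀ (by positivity), ← mul_pow] at h'
          have h'' := lt_of_pow_lt_pow_left₀ 2 (by positivity) h'
          nlinarith
      have e2 : tri T w (cv β f) (cv β f) (cv β f) - 3 * (κ * Fintype.card G)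
          ≤ tri T w (cv β' f) (cv β' f) (cv β' f) := by
        refine cmp_l1 T hw (cv β' f) (cv β f) g0' g1' g0 g1 _ ?_
        refine abs_sum_of_sq (fun x => cv β' f x - cv β f x) κ hκ.le ?_
        have := energy_diff hβ hβ' f f0 f1 τ hτ.le hb1
        have h4 : 2 * τ * Fintype.card G = κ ^ 2 / 2 * Fintype.card G := by rw [hτdef]; ring
        rw [h4] at this
        linarith
      have e3 : ∑ x, cv β f x ^ 3 - 2 * (2 * τ * Fintype.card G)
          ≤ tri T w (cv β f) (cv β f) (cv β f) := by
        refine cmp_shift T hw (cv β f) g0 g1 _ ?_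
        intro d hd
        have hsm : ∀ χ ∈ _, _ := (hws d hd).2
        have n2 : ∀ (χ : AddChar G ℂ) (x : G), ‖χ x - 1‖ ≤ 2 := fun χ x =>
          (norm_sub_le _ _).trans (by rw [norm_char]; norm_num)
        have gen : ∀ x : G, (∀ χ ∈ S, ‖χ x - 1‖ ≤ τ) → ∀ χ, b χ * ‖χ x - 1‖ ≤ 2 * τ := by
          intro x hx χ
          have p0 := hβ.b_nonneg χ
          have p1 := hβ.b_le χ
          have p2 := n2 χ x
          have p3 := norm_nonneg (χ x - 1)
          by_cases h : τ ≤ b χ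
          · have := hx χ (by simp [hS, h])
            nlinarith
          · push Not at h
            nlinarith
        refine ⟨shift_small hβ f f0 f1 τ hτ.le d (gen d fun χ hχ => ?_),
          shift_small hβ f f0 f1 τ hτ.le (T d) (gen (T d) fun χ hχ => ?_)⟩
        · exact hsm χ (Finset.mem_union_left _ hχ)
        · exact hsm (χ.compAddMonoidHom T)
            (Finset.mem_union_right _ (Finset.mem_image_of_mem _ hχ))
      have e4 := cube_mean (cv β f) g0
      rw [sum_cv hβ] at e4
      have e5 : Cw * (σ * Fintype.card G) = κ * Fintype.card G := by
        rw [hσdef]; field_simp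
      have e6 : 2 * τ * Fintype.card G ≤ κ / 2 * Fintype.card G := by
        refine mul_le_mul_of_nonneg_right ?_ hn.le
        rw [hτdef]; nlinarith
      rw [e5] at e1
      linarith

lemma main_group (κ : ℝ) (hκ : 0 < κ) (hκ1 : κ ≤ 1) (m : ℕ) : ∃ n₀ : ℝ,
    ∀ (G : Type) [AddCommGroup G] [Fintype G] (T : G →+ G) (_ : Function.Surjective T)
      (_ : Function.Surjective (AddMonoidHom.id G - T)) (c : G → Fin m) (f : G → ℝ)
      (_ : ∀ x, 0 ≤ f x) (_ : ∀ x, f x ≤ 1), n₀ < Fintype.card G →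
      ∃ x y, c x = c y ∧ x ≠ y ∧
        (((∑ x, f x) / Fintype.card G) ^ 3 - 8 * κ) * Fintype.card G
          ≤ ∑ z, f z * f (z + (x - y)) * f (z + T (x - y)) := by
  classical
  obtain ⟨j, hj⟩ := exists_nat_gt (1 / (κ ^ 2 / 2))
  rw [div_lt_iff₀ (by positivity)] at hj
  obtain ⟨C', H⟩ := main_iter κ hκ hκ1 m j 1
  refine ⟨9 * C' / κ, ?_⟩
  intro G _ _ T hT hU c f f0 f1 hlarge
  have hn : (0 : ℝ) < Fintype.card G := by exact_mod_cast Fintype.card_pos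
  obtain ⟨β, b, hβ, -⟩ := exists_ker (G := G) (ι := Unit) (fun _ => ())
  simp only [Fintype.card_unit, Nat.cast_one] at hβ
  obtain ⟨w, bw, hw, hs, ht⟩ := H G T hT hU c f f0 f1 β b hβ (by
    have : 0 ≤ ∑ x, cv β f x ^ 2 := Finset.sum_nonneg fun _ _ => by positivity
    nlinarith)
  set n : ℝ := (Fintype.card G : ℝ) with hndef
  set a : ℝ := ((∑ x, f x) / n) ^ 3 with ha
  by_contra! hcon
  have hsum : 0 ≤ ∑ x, f x := Finset.sum_nonneg fun x _ => f0 x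
  have ha0 : 0 ≤ a := by positivity
  let L : G → ℝ := fun d => ∑ z, f z * f (z + d) * f (z + T d)
  have hL : ∀ d, L d ≤ n := by
    intro d
    calc L d ≤ ∑ _z : G, (1 : ℝ) := Finset.sum_le_sum fun z _ =>
          mul_le_one₀ (mul_le_one₀ (f1 _) (f0 _) (f1 _)) (f0 _) (f1 _)
      _ = n := by simp [hndef]
  have h1 : tri T w f f f - (a - 8 * κ) * n = ∑ d, w d * (L d - (a - 8 * κ) * n) := by
    simp only [mul_sub (w _), Finset.sum_sub_distrib]
    rw [← Finset.sum_mul, hw.sum_one, one_mul]; rfl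
  have h2 : ∑ d, w d * (L d - (a - 8 * κ) * n) ≤ ∑ d : G, if d = 0 then w 0 * (9 * n) else 0 := by
    refine Finset.sum_le_sum fun d _ => ?_
    split_ifs with hd
    · subst hd
      refine mul_le_mul_of_nonneg_left ?_ (hw.nonneg 0)
      have := hL 0
      nlinarith
    · by_cases hz : w d = 0
      · simp [hz]
      · obtain ⟨x, y, hxy, rfl⟩ := hs d hz
        have := hcon x y hxy (fun h => hd (by rw [h, sub_self]))
        have h3 : L (x - y) - (a - 8 * κ) * n ≤ 0 := by
          simp only [L]; linarith
        exact mul_nonpos_of_nonneg_of_nonpos (hw.nonneg _) h3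
  rw [Finset.sum_ite_eq' univ (0 : G)] at h2
  simp only [Finset.mem_univ, if_true] at h2
  have h3 := hw.zero_le
  rw [← hndef] at h3
  rw [div_lt_iff₀ hκ] at hlarge
  nlinarith

section Torus

/-- Rotation by a right angle. -/
def rot (M : ℕ) : ZMod M × ZMod M →+ ZMod M × ZMod M where
  toFun z := (-z.2, z.1)
  map_zero' := by simp
  map_add' x y := by ext <;> simp; abel

lemma rot_surj (M : ℕ) : Function.Surjective (rot M) := by
  rintro ⟨a, b⟩
  exact ⟨(b, -a), by simp [rot]⟩

lemma id_sub_rot_surj (M : ℕ) (hM : Odd M) :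
    Function.Surjective (AddMonoidHom.id (ZMod M × ZMod M) - rot M) := by
  obtain ⟨k, hk⟩ := hM
  have h2 : (2 : ZMod M) * (-k) = 1 := by
    have : ((M : ℕ) : ZMod M) = 0 := ZMod.natCast_self M
    have h3 : ((2 * k + 1 : ℕ) : ZMod M) = 0 := by rw [← hk]; exact this
    push_cast at h3
    linear_combination -h3
  rintro ⟨u, v⟩
  refine ⟨((u - v) * (-k), (u + v) * (-k)), ?_⟩
  simp only [rot, AddMonoidHom.sub_apply, AddMonoidHom.id_apply, AddMonoidHom.coe_mk,
    ZeroHom.coe_mk, Prod.mk_sub_mk]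
  ext
  · simp only; linear_combination u * h2
  · simp only; linear_combination v * h2

lemma val_shift (M : ℕ) [NeZero M] (z x y : ZMod M)
    (h0 : 0 ≤ (z.val : ℤ) + ((x.val : ℤ) - y.val)) (h1 : (z.val : ℤ) + ((x.val : ℤ) - y.val) < M) :
    ((z + (x - y)).val : ℤ) = (z.val : ℤ) + ((x.val : ℤ) - y.val) := by
  obtain ⟨k, hk⟩ := Int.eq_ofNat_of_zero_le h0
  have hz : z + (x - y) = (k : ZMod M) := by
    have := congrArg (Int.cast : ℤ → ZMod M) hk
    push_cast at this
    simpa using this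
  rw [hz, ZMod.val_cast_of_lt (by omega), hk]

lemma card_edge (M h : ℕ) [NeZero M] :
    #(univ.filter fun t : ZMod M => t.val < h ∨ M ≤ t.val + h) ≤ 2 * h := by
  classical
  have e : #(univ.filter fun t : ZMod M => t.val < h ∨ M ≤ t.val + h)
      ≤ #(range h ∪ Finset.Ico (M - h) M) := by
    refine Finset.card_le_card_of_injOn (fun t => t.val) ?_ ?_
    · intro t ht
      have := ZMod.val_lt t
      simp only [Finset.coe_filter, Finset.mem_univ, true_and, Set.mem_ofPred_eq] at ht
      simp only [Finset.coe_union, Set.mem_union, Finset.coe_range, Set.mem_Iio, Finset.coe_Ico,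
        Set.mem_Ico]
      omega
    · intro a _ c _ hac
      exact ZMod.val_injective M hac
  refine e.trans ((Finset.card_union_le _ _).trans ?_)
  simp only [Finset.card_range, Nat.card_Ico]
  omega

/-- lift to the box `{1,…,M}²` -/
def lft (M : ℕ) (z : ZMod M × ZMod M) : ℤ × ℤ := ((z.1.val : ℤ) + 1, (z.2.val : ℤ) + 1)

lemma lft_inj (M : ℕ) [NeZero M] : Function.Injective (lft M) := by
  rintro ⟨a, b⟩ ⟨c, d⟩ h
  simp only [lft, Prod.mk.injEq, add_left_inj, Nat.cast_inj] at h
  exact Prod.ext (ZMod.val_injective M h.1) (ZMod.val_injective M h.2)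

lemma lft_card (M : ℕ) [NeZero M] (A : Finset (ℤ × ℤ))
    (hA : A ⊆ (Finset.Icc 1 (M : ℤ)) ×ˢ (Finset.Icc 1 (M : ℤ))) :
    #(univ.filter fun z : ZMod M × ZMod M => lft M z ∈ A) = #A := by
  classical
  rw [← Finset.card_image_of_injective _ (lft_inj M)]
  congr 1
  ext ⟨a, b⟩
  simp only [Finset.mem_image, Finset.mem_filter, Finset.mem_univ, true_and]
  constructor
  · rintro ⟨z, hz, h⟩
    rwa [← h]
  · intro hab
    have := hA hab
    simp only [Finset.mem_product, Finset.mem_Icc] at this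
    have hl : lft M (((a - 1).toNat : ZMod M), ((b - 1).toNat : ZMod M)) = (a, b) := by
      simp only [lft]
      rw [ZMod.val_cast_of_lt (by omega), ZMod.val_cast_of_lt (by omega)]
      ext <;> simp <;> omega
    exact ⟨_, by rw [hl]; exact hab, hl⟩

lemma torus (κ : ℝ) (hκ : 0 < κ) (hκ1 : κ ≤ 1) (q : ℕ) (hq : 0 < q) : ∃ n₀ : ℝ,
    ∀ M : ℕ, Odd M → n₀ < (M : ℝ) ^ 2 → ∀ A : Finset (ℤ × ℤ),
      A ⊆ (Finset.Icc 1 (M : ℤ)) ×ˢ (Finset.Icc 1 (M : ℤ)) →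
      ∃ m n : ℤ, (m, n) ≠ (0, 0) ∧
        (((#A : ℝ) / (M : ℝ) ^ 2) ^ 3 - 8 * κ) * (M : ℝ) ^ 2 - 4 * ((M : ℝ) / q) * M ≤
          (#(A.filter (fun p => p + (m, n) ∈ A ∧ p + (-n, m) ∈ A)) : ℝ) := by
  classical
  obtain ⟨n₀, H⟩ := main_group κ hκ hκ1 (q * q)
  refine ⟨n₀, ?_⟩
  intro M hM hlarge A hA
  have hMpos : 0 < M := hM.pos
  have : NeZero M := ⟨hMpos.ne'⟩
  have hcol : ∀ t : ZMod M, t.val * q / M < q := by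
    intro t
    rw [Nat.div_lt_iff_lt_mul hMpos, mul_comm]
    exact Nat.mul_lt_mul_of_pos_left (ZMod.val_lt t) hq
  let c : ZMod M × ZMod M → Fin (q * q) := fun z =>
    finProdFinEquiv (⟨z.1.val * q / M, hcol z.1⟩, ⟨z.2.val * q / M, hcol z.2⟩)
  let f : ZMod M × ZMod M → ℝ := fun z => if lft M z ∈ A then 1 else 0
  have f0 : ∀ z, 0 ≤ f z := fun z => by simp only [f]; split_ifs <;> norm_num
  have f1 : ∀ z, f z ≤ 1 := fun z => by simp only [f]; split_ifs <;> norm_num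
  have hcard : (Fintype.card (ZMod M × ZMod M) : ℝ) = (M : ℝ) ^ 2 := by
    simp [ZMod.card, sq]
  have hsum : ∑ z, f z = #A := by
    rw [← lft_card M A hA]; simp [f]
  obtain ⟨x, y, hxy, hne, hbig⟩ := H (ZMod M × ZMod M) (rot M) (rot_surj M)
    (id_sub_rot_surj M hM) c f f0 f1 (by rw [hcard]; exact hlarge)
  rw [hcard, hsum] at hbig
  set h : ℕ := M / q with hh
  have close : ∀ s t : ZMod M, s.val * q / M = t.val * q / M →
      (s.val : ℤ) - t.val ≤ h ∧ (t.val : ℤ) - s.val ≤ h := by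
    have one : ∀ u v : ℕ, u * q / M = v * q / M → u - v ≤ h := by
      intro u v huv
      rw [hh, Nat.le_div_iff_mul_le hq]
      have a1 := Nat.lt_mul_div_succ (u * q) hMpos
      have a2 := Nat.mul_div_le (v * q) M
      rw [← huv] at a2
      rw [Nat.mul_succ] at a1
      rw [Nat.sub_mul]
      omega
    intro s t hst
    have b1 := one _ _ hst
    have b2 := one _ _ hst.symm
    omega
  have hxy' := finProdFinEquiv.injective hxy
  rw [Prod.mk.injEq, Fin.mk.injEq, Fin.mk.injEq] at hxy'
  obtain ⟨c1, c1'⟩ := close _ _ hxy'.1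
  obtain ⟨c2, c2'⟩ := close _ _ hxy'.2
  set m : ℤ := (x.1.val : ℤ) - y.1.val with hm
  set n : ℤ := (x.2.val : ℤ) - y.2.val with hn
  refine ⟨m, n, ?_, ?_⟩
  · intro h0
    rw [Prod.mk.injEq] at h0
    apply hne
    exact Prod.ext (ZMod.val_injective M (by omega)) (ZMod.val_injective M (by omega))
  -- counting
  set P : Finset (ZMod M × ZMod M) := univ.filter fun z =>
    lft M z ∈ A ∧ lft M (z + (x - y)) ∈ A ∧ lft M (z + rot M (x - y)) ∈ A with hP
  have hPsum : ∑ z, f z * f (z + (x - y)) * f (z + rot M (x - y)) = #P := by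
    rw [hP, Finset.card_filter]
    push_cast
    refine Finset.sum_congr rfl fun z _ => ?_
    simp only [f]
    by_cases h1 : lft M z ∈ A <;> by_cases h2 : lft M (z + (x - y)) ∈ A <;>
      by_cases h3 : lft M (z + rot M (x - y)) ∈ A <;> simp [h1, h2, h3]
  rw [hPsum] at hbig
  set E : Finset (ZMod M) := univ.filter fun t => t.val < h ∨ M ≤ t.val + h with hE
  set Q := A.filter (fun p => p + (m, n) ∈ A ∧ p + (-n, m) ∈ A) with hQ
  have hsub : P ⊆ (univ.filter fun z => lft M z ∈ Q) ∪ (E ×ˢ univ ∪ univ ×ˢ E) := by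
    intro z hz
    simp only [hP, Finset.mem_filter, Finset.mem_univ, true_and] at hz
    simp only [Finset.mem_union, Finset.mem_product, Finset.mem_univ, and_true, true_and,
      Finset.mem_filter]
    by_cases e1 : z.1 ∈ E
    · exact Or.inr (Or.inl e1)
    by_cases e2 : z.2 ∈ E
    · exact Or.inr (Or.inr e2)
    left
    simp only [hE, Finset.mem_filter, Finset.mem_univ, true_and, not_or, not_lt, not_le] at e1 e2
    rw [hQ, Finset.mem_filter]
    have v1 := val_shift M z.1 x.1 y.1 (by omega) (by omega)
    have v2 := val_shift M z.2 x.2 y.2 (by omega) (by omega)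
    have v3 := val_shift M z.1 y.2 x.2 (by omega) (by omega)
    have v4 := val_shift M z.2 x.1 y.1 (by omega) (by omega)
    have l1 : lft M (z + (x - y)) = lft M z + (m, n) := by
      simp only [lft, Prod.fst_add, Prod.snd_add, Prod.fst_sub, Prod.snd_sub, v1, v2,
        Prod.mk_add_mk, Prod.mk.injEq]
      omega
    have l2 : lft M (z + rot M (x - y)) = lft M z + (-n, m) := by
      have r1 : rot M (x - y) = (y.2 - x.2, x.1 - y.1) := by
        simp [rot]
      rw [r1]
      simp only [lft, Prod.fst_add, Prod.snd_add, v3, v4,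
        Prod.mk_add_mk, Prod.mk.injEq]
      omega
    rw [← l1, ← l2]
    exact hz
  have hQA : Q ⊆ (Finset.Icc 1 (M : ℤ)) ×ˢ (Finset.Icc 1 (M : ℤ)) :=
    (Finset.filter_subset _ _).trans hA
  have hcount : #P ≤ #Q + (2 * h * M + M * (2 * h)) := by
    refine (Finset.card_le_card hsub).trans ((Finset.card_union_le _ _).trans ?_)
    rw [lft_card M Q hQA]
    refine add_le_add le_rfl ((Finset.card_union_le _ _).trans ?_)
    rw [Finset.card_product, Finset.card_product, Finset.card_univ, ZMod.card]
    exact add_le_add (Nat.mul_le_mul_right _ (card_edge M h))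
      (Nat.mul_le_mul_left _ (card_edge M h))
  have hcount' : (#P : ℝ) ≤ #Q + (2 * h * M + M * (2 * h)) := by exact_mod_cast hcount
  have hhq : (h : ℝ) ≤ (M : ℝ) / q := Nat.cast_div_le
  have hM0 : (0 : ℝ) ≤ M := by positivity
  have := mul_le_mul_of_nonneg_right hhq hM0
  linarith

end Torus

end PopDiff

/-- **main theorem.** For every `ε ∈ (0,1]` there exists `N₀` such that for
all `N ≥ N₀` and every `A ⊆ {1,…,N}²` with density `α = |A|/N²`, there is
`(m,n) ∈ ℤ² \ {(0,0)}` such that `A` contains at least `(α³ - ε)N²` triples of points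
`(a,b), (a+m,b+n), (a-n,b+m)` with this fixed `(m,n)`; equivalently
`|A ∩ (A - (m,n)) ∩ (A - (-n,m))| ≥ (α³ - ε)N²`. -/
theorem popular_difference_right_isosceles (ε : ℝ) (hε : ε ∈ Set.Ioc (0 : ℝ) 1) :
    ∃ N₀ : ℕ, ∀ N : ℕ, N₀ ≤ N →
      ∀ A : Finset (ℤ × ℤ),
        A ⊆ (Finset.Icc 1 (N : ℤ)) ×ˢ (Finset.Icc 1 (N : ℤ)) →
        ∀ α : ℝ, α = (A.card : ℝ) / (N : ℝ) ^ 2 →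
          ∃ m n : ℤ, (m, n) ≠ (0, 0) ∧
            (((A.filter (fun p => p + (m, n) ∈ A ∧ p + (-n, m) ∈ A)).card : ℝ) ≥
              (α ^ 3 - ε) * (N : ℝ) ^ 2) := by
  obtain ⟨hε0, hε1⟩ := hε
  obtain ⟨q, hq⟩ := exists_nat_gt (64 / ε)
  have hq0 : (0 : ℝ) < q := lt_trans (by positivity) hq
  obtain ⟨n₀, H⟩ := PopDiff.torus (ε / 128) (by positivity) (by linarith) q (by exact_mod_cast hq0)
  obtain ⟨N₁, hN₁⟩ := exists_nat_gt (max n₀ (8 / ε))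
  refine ⟨N₁, ?_⟩
  intro N hN A hA α hα
  have hNr : max n₀ (8 / ε) < N := lt_of_lt_of_le hN₁ (by exact_mod_cast hN)
  have hNn : n₀ < N := lt_of_le_of_lt (le_max_left _ _) hNr
  have hNe : 8 / ε < N := lt_of_le_of_lt (le_max_right _ _) hNr
  have h8 : (8 : ℝ) ≤ 8 / ε := by rw [le_div_iff₀ hε0]; linarith
  have hN8 : (8 : ℝ) < N := lt_of_le_of_lt h8 hNe
  have hN0 : (0 : ℝ) < N := by linarith
  obtain ⟨M, hodd, hM1, hM2⟩ : ∃ M : ℕ, Odd M ∧ N ≤ M ∧ M ≤ N + 1 := by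
    rcases Nat.even_or_odd N with h | h
    · exact ⟨N + 1, h.add_one, by omega, le_rfl⟩
    · exact ⟨N, h, le_rfl, by omega⟩
  have hM1' : (N : ℝ) ≤ M := by exact_mod_cast hM1
  have hM2' : (M : ℝ) ≤ N + 1 := by exact_mod_cast hM2
  have hM0 : (0 : ℝ) < M := by linarith
  obtain ⟨m, n, hmn, hc⟩ := H M hodd (by nlinarith) A (hA.trans (by
    have : Finset.Icc (1 : ℤ) N ⊆ Finset.Icc (1 : ℤ) M :=
      Finset.Icc_subset_Icc le_rfl (by exact_mod_cast hM1)
    exact Finset.product_subset_product this this))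
  refine ⟨m, n, hmn, ?_⟩
  refine le_trans ?_ hc
  have hAcard : (A.card : ℝ) ≤ (N : ℝ) ^ 2 := by
    have := Finset.card_le_card hA
    simp only [Finset.card_product, Int.card_Icc, add_sub_cancel_right, Int.toNat_natCast] at this
    rw [sq]; exact_mod_cast this
  have hα0 : 0 ≤ α := by rw [hα]; positivity
  have hα1 : α ≤ 1 := by rw [hα]; exact (div_le_one (by positivity)).2 hAcard
  have hα31 : α ^ 3 ≤ 1 := pow_le_one₀ hα0 hα1
  have hα30 : 0 ≤ α ^ 3 := by positivity
  have hAα : (A.card : ℝ) = α * (N : ℝ) ^ 2 := by rw [hα]; field_simp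
  set r : ℝ := (N : ℝ) / M with hr
  have hrM : (N : ℝ) = r * M := by rw [hr]; field_simp
  have e1 : ((A.card : ℝ) / (M : ℝ) ^ 2) ^ 3 * (M : ℝ) ^ 2 = α ^ 3 * (N : ℝ) ^ 2 * r ^ 4 := by
    rw [hAα, hr]; field_simp
  have hr1 : 1 - r ≤ ε / 8 := by
    have a1 : 1 - r = ((M : ℝ) - N) / M := by rw [hr]; field_simp
    rw [a1, div_le_iff₀ hM0]
    rw [div_lt_iff₀ hε0] at hNe
    nlinarith
  have hr4 : 1 - ε / 2 ≤ r ^ 4 := by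
    have hr0 : 0 ≤ r := by positivity
    have := one_add_mul_le_pow (a := r - 1) (by linarith) 4
    push_cast at this
    have e : 1 + (r - 1) = r := by ring
    rw [e] at this
    linarith
  have hM4 : (M : ℝ) ^ 2 ≤ 4 * (N : ℝ) ^ 2 := by nlinarith
  have e2 : 4 * ((M : ℝ) / q) * M ≤ ε / 4 * (N : ℝ) ^ 2 := by
    have a1 : 4 * ((M : ℝ) / q) * M = 4 * (M : ℝ) ^ 2 / q := by field_simp
    rw [a1, div_le_iff₀ hq0]
    rw [div_lt_iff₀ hε0] at hq
    have : 0 ≤ (N : ℝ) ^ 2 := by positivity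
    nlinarith
  have e3 : α ^ 3 * (N : ℝ) ^ 2 * (1 - ε / 2) ≤ α ^ 3 * (N : ℝ) ^ 2 * r ^ 4 :=
    mul_le_mul_of_nonneg_left hr4 (by positivity)
  have e4 : α ^ 3 * ((N : ℝ) ^ 2 * (ε / 2)) ≤ 1 * ((N : ℝ) ^ 2 * (ε / 2)) :=
    mul_le_mul_of_nonneg_right hα31 (by positivity)
  have e5 : ε / 128 * 8 * (M : ℝ) ^ 2 ≤ ε / 128 * 8 * (4 * (N : ℝ) ^ 2) :=
    mul_le_mul_of_nonneg_left hM4 (by positivity)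
  rw [sub_mul, sub_mul, e1]
  linarith
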